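/- Let μ > 0 and A > (√2 − 1)·√μ. Let u : ℝ → ℝ be twice differentiable with u''(t) = −u(t)·(u(t)² − μ), u(0) = A + √μ, and u'(0) = 0. Then there exists t > 0 with u(t) < 0. That is, above the threshold amplitude the solution crosses zero and the transition from the stable state √μ toward the other side occurs (type ii oscillation, dynamical symmetry breaking). -/

import Mathlib

/-- Above the threshold amplitude the transition occurs (type ii oscillation,
dynamical symmetry breaking): if `μ > 0`, `A > (√2 − 1)·√μ`, and
`u'' = −u(u² − μ)` with `u(0) = A + √μ`, `u'(0) = 0`, then `u(t) < 0` for some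
`t > 0`. -/
theorem stmt_10 (μ A : ℝ) (hμ : 0 < μ)
    (hAgt : (Real.sqrt 2 - 1) * Real.sqrt μ < A) (u : ℝ → ℝ)
    (hu : Differentiable ℝ u) (hu' : Differentiable ℝ (deriv u))
    (hode : ∀ t : ℝ, deriv (deriv u) t = -u t * (u t ^ 2 - μ))
    (h0 : u 0 = A + Real.sqrt μ) (h0' : deriv u 0 = 0) :
    ∃ t : ℝ, 0 < t ∧ u t < 0 := by
  by_contra! hneg
  obtain ⟨B, hB⟩ : ∃ B, B = u 0 := ⟨_, rfl⟩
  have hs2 : Real.sqrt 2 ^ 2 = 2 := Real.sq_sqrt (by norm_num)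
  have hsμ : Real.sqrt μ ^ 2 = μ := Real.sq_sqrt hμ.le
  have hp : 0 < Real.sqrt 2 * Real.sqrt μ := by positivity
  have hBgt : Real.sqrt 2 * Real.sqrt μ < B := by rw [hB, h0]; linarith
  have hB0 : 0 < B := hp.trans hBgt
  have hk : 0 < B ^ 2 - 2 * μ := by
    have h1 : (Real.sqrt 2 * Real.sqrt μ) ^ 2 = 2 * μ := by rw [mul_pow, hs2, hsμ]
    nlinarith
  have hdu : ∀ t, HasDerivAt u (deriv u t) t := fun t => (hu t).hasDerivAt
  have hdv : ∀ t, HasDerivAt (deriv u) (-u t * (u t ^ 2 - μ)) t := fun t => by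
    rw [← hode t]; exact (hu' t).hasDerivAt
  have hE : ∀ t, deriv u t ^ 2 + u t ^ 4 / 2 - μ * u t ^ 2 = B ^ 4 / 2 - μ * B ^ 2 := by
    have hd : ∀ t, HasDerivAt (fun t => deriv u t ^ 2 + u t ^ 4 / 2 - μ * u t ^ 2) 0 t := by
      intro t
      have := ((((hdv t).pow 2).add (((hdu t).pow 4).div_const 2)).sub
        (((hdu t).pow 2).const_mul μ))
      refine HasDerivAt.congr_deriv (f := fun t => deriv u t ^ 2 + u t ^ 4 / 2 - μ * u t ^ 2) this ?_
      push_cast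
      ring
    intro t
    have := is_const_of_deriv_eq_zero (fun t => (hd t).differentiableAt)
      (fun t => (hd t).deriv) t 0
    rw [this, h0', hB]; ring
  have hE' : ∀ t, deriv u t ^ 2 = (B ^ 2 - u t ^ 2) * (B ^ 2 + u t ^ 2 - 2 * μ) / 2 := by
    intro t; linarith [hE t]
  have hvc : Continuous (deriv u) := hu'.continuous
  obtain ⟨t0, ht0, hv0, hu0⟩ : ∃ t0, 0 < t0 ∧ deriv u t0 < 0 ∧ u t0 < B := by
    have hneg0 : deriv (deriv u) 0 < 0 := by
      rw [hode, ← hB]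
      have : 0 < B * (B ^ 2 - μ) := mul_pos hB0 (by linarith)
      linarith
    have hev : ∀ᶠ t in nhdsWithin 0 (Set.Ioi (0:ℝ)), deriv u t < 0 := by
      have h1 := (hasDerivAt_iff_tendsto_slope.1 (hu' 0).hasDerivAt).eventually_lt_const hneg0
      have h2 : ∀ᶠ t in nhdsWithin 0 (Set.Ioi (0:ℝ)), slope (deriv u) 0 t < 0 :=
        h1.filter_mono (nhdsWithin_mono _ (fun x hx => ne_of_gt hx))
      filter_upwards [h2, self_mem_nhdsWithin] with t ht htp
      have htp' : 0 < t := htp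
      rw [slope_def_field, h0', sub_zero, sub_zero] at ht
      by_contra! hc
      exact absurd (div_nonneg hc htp'.le) (not_le.2 ht)
    obtain ⟨d, hd, hd'⟩ := mem_nhdsGT_iff_exists_Ioo_subset.1 hev
    have hd0 : 0 < d := hd
    have hd2 : ∀ t, 0 < t → t < d → deriv u t < 0 := fun t h1 h2 => hd' ⟨h1, h2⟩
    refine ⟨d / 2, by linarith, hd2 _ (by linarith) (by linarith), ?_⟩
    have := strictAntiOn_of_deriv_neg (convex_Icc 0 (d / 2)) hu.continuous.continuousOn
      (fun x hx => by
        rw [interior_Icc] at hx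
        exact hd2 x hx.1 (by linarith [hx.2]))
    rw [hB]
    exact this ⟨le_refl _, by linarith⟩ ⟨by linarith, le_refl _⟩ (by linarith)
  have hnz : ∀ t, 0 < t → u t < B → deriv u t ≠ 0 := by
    intro t ht hlt h
    have h1 := hE' t
    have h2 := hneg t ht
    have h3 : 0 < B ^ 2 - u t ^ 2 := by nlinarith
    have h4 : 0 < B ^ 2 + u t ^ 2 - 2 * μ := by nlinarith
    have := mul_pos h3 h4
    rw [h] at h1
    linarith
  have hv : ∀ t, t0 ≤ t → deriv u t < 0 := by
    by_contra! hc
    obtain ⟨T, hT, hvT⟩ := hc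
    have hcomp : IsCompact (Set.Icc t0 T ∩ {t | deriv u t = 0}) :=
      isCompact_Icc.inter_right (isClosed_eq hvc continuous_const)
    obtain ⟨z, hz, hz0⟩ := intermediate_value_Icc hT hvc.continuousOn ⟨hv0.le, hvT⟩
    obtain ⟨τ, ⟨hτ, hτ0⟩, hmin⟩ := hcomp.exists_isLeast ⟨z, hz, hz0⟩
    have hneg' : ∀ x, t0 ≤ x → x < τ → deriv u x < 0 := by
      intro x hx hxτ
      by_contra! hcx
      obtain ⟨y, hy, hy0⟩ := intermediate_value_Icc hx hvc.continuousOn ⟨hv0.le, hcx⟩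
      have := hmin ⟨⟨hy.1, by linarith [hy.2, hτ.2]⟩, hy0⟩
      linarith [hy.2]
    have := antitoneOn_of_deriv_nonpos (convex_Icc t0 τ) hu.continuous.continuousOn
      hu.differentiableOn
      (fun x hx => by
        rw [interior_Icc] at hx
        exact (hneg' x hx.1.le hx.2).le)
    have h1 := this ⟨le_refl _, hτ.1⟩ ⟨hτ.1, le_refl _⟩ hτ.1
    exact hnz τ (by linarith [hτ.1]) (by linarith) hτ0
  have hanti := antitoneOn_of_deriv_nonpos (convex_Ici t0) hu.continuous.continuousOn
      hu.differentiableOn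
      (fun x hx => by
        rw [interior_Ici] at hx
        exact (hv x (le_of_lt hx)).le)
  obtain ⟨c, hc⟩ : ∃ c, c = (B ^ 2 - u t0 ^ 2) * (B ^ 2 - 2 * μ) / 2 := ⟨_, rfl⟩
  have hu0' := hneg t0 ht0
  have hcpos : 0 < c := by
    have : 0 < B ^ 2 - u t0 ^ 2 := by nlinarith
    rw [hc]; positivity
  have hvle : ∀ t, t0 ≤ t → deriv u t ≤ -Real.sqrt c := by
    intro t ht
    have h1 : u t ≤ u t0 := hanti (Set.mem_Ici.2 le_rfl) ht ht
    have h2 := hneg t (by linarith)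
    have h3 : u t ^ 2 ≤ u t0 ^ 2 := by nlinarith
    have h4 : c ≤ deriv u t ^ 2 := by
      rw [hE' t, hc]
      have h5 : 0 < B ^ 2 - u t0 ^ 2 := by nlinarith
      have : (B ^ 2 - u t0 ^ 2) * (B ^ 2 - 2 * μ)
          ≤ (B ^ 2 - u t ^ 2) * (B ^ 2 + u t ^ 2 - 2 * μ) :=
        mul_le_mul (by linarith) (by nlinarith) hk.le (by linarith)
      linarith
    have h5 : Real.sqrt c ≤ -deriv u t :=
      Real.sqrt_le_iff.2 ⟨by linarith [hv t ht], by rw [neg_sq]; exact h4⟩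
    linarith
  have hsc : 0 < Real.sqrt c := Real.sqrt_pos.2 hcpos
  obtain ⟨T, hT⟩ : ∃ T, T = t0 + (B + 1) / Real.sqrt c := ⟨_, rfl⟩
  have hTt : t0 ≤ T := by
    have : 0 < (B + 1) / Real.sqrt c := by positivity
    linarith
  have hfin := (convex_Ici t0).image_sub_le_mul_sub_of_deriv_le hu.continuous.continuousOn
    hu.differentiableOn (C := -Real.sqrt c)
    (fun x hx => by
        rw [interior_Ici] at hx
        exact hvle x (le_of_lt hx)) t0 (Set.mem_Ici.2 le_rfl) T hTt hTt
  have h6 : -Real.sqrt c * (T - t0) = -(B + 1) := by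
    rw [hT]; field_simp; ring
  have h7 := hneg T (by linarith)
  linarith
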